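/- arXiv:2312.11329 — 2 statements merged into one kernel-verified Lean document; each statement's English description precedes it below -/
import Mathlib

section
/- One-step refinement of the upper bound is controlled by the uncertainty at the new data point: if z⁺ ∈ Z and D′ := D ∪ {z⁺}, then for every z ∈ ℝ^d and every component i, 0 ≤ w^max_D(z)_i − w^max_{D′}(z)_i ≤ w^max_D(z⁺)_i − w^min_D(z⁺)_i. -/
open scoped Classical

/-- Kinky-inference upper confidence bound (componentwise):
`w^max_D(z)_i = min_{y ∈ D} (f_i(y) + q‖z − y‖^λ)`. -/
noncomputable def wmax {d n : ℕ} (f : EuclideanSpace ℝ (Fin d) → EuclideanSpace ℝ (Fin n))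
    (q lam : ℝ) (D : Finset (EuclideanSpace ℝ (Fin d))) (hD : D.Nonempty)
    (z : EuclideanSpace ℝ (Fin d)) (i : Fin n) : ℝ :=
  D.inf' hD fun y => f y i + q * ‖z - y‖ ^ lam

/-- Kinky-inference lower confidence bound (componentwise):
`w^min_D(z)_i = max_{y ∈ D} (f_i(y) − q‖z − y‖^λ)`. -/
noncomputable def wmin {d n : ℕ} (f : EuclideanSpace ℝ (Fin d) → EuclideanSpace ℝ (Fin n))
    (q lam : ℝ) (D : Finset (EuclideanSpace ℝ (Fin d))) (hD : D.Nonempty)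
    (z : EuclideanSpace ℝ (Fin d)) (i : Fin n) : ℝ :=
  D.sup' hD fun y => f y i - q * ‖z - y‖ ^ lam

/-- The `lam`-th power of the norm distance satisfies the triangle inequality for `lam ∈ [0, 1]`. -/
theorem norm_sub_rpow_le_add {E : Type*} [SeminormedAddCommGroup E] {lam : ℝ}
    (h0 : 0 ≤ lam) (h1 : lam ≤ 1) (x y z : E) :
    ‖x - z‖ ^ lam ≤ ‖x - y‖ ^ lam + ‖y - z‖ ^ lam :=
  (Real.rpow_le_rpow (norm_nonneg _) (norm_sub_le_norm_sub_add_norm_sub x y z) h0).trans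
    (Real.rpow_add_le_add_rpow (norm_nonneg _) (norm_nonneg _) h0 h1)

/-- The upper confidence bound is itself Hölder continuous, with the same constants. -/
theorem wmax_le_wmax_add {d n : ℕ} (f : EuclideanSpace ℝ (Fin d) → EuclideanSpace ℝ (Fin n))
    {q lam : ℝ} (hq : 0 ≤ q) (h0 : 0 ≤ lam) (h1 : lam ≤ 1)
    (D : Finset (EuclideanSpace ℝ (Fin d))) (hD : D.Nonempty)
    (z w : EuclideanSpace ℝ (Fin d)) (i : Fin n) :
    wmax f q lam D hD z i ≤ wmax f q lam D hD w i + q * ‖z - w‖ ^ lam := by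
  obtain ⟨y, hy, hyw⟩ := D.exists_mem_eq_inf' hD fun y => f y i + q * ‖w - y‖ ^ lam
  have hle : wmax f q lam D hD z i ≤ f y i + q * ‖z - y‖ ^ lam := Finset.inf'_le _ hy
  have htri := mul_le_mul_of_nonneg_left (norm_sub_rpow_le_add h0 h1 z w y) hq
  have hw : wmax f q lam D hD w i = f y i + q * ‖w - y‖ ^ lam := hyw
  linarith

/-- One-step refinement of the upper bound is controlled by the
uncertainty at the new data point: if `z⁺ ∈ Z` and `D′ := D ∪ {z⁺}`, then for every
`z ∈ ℝ^d` and component `i`,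
`0 ≤ w^max_D(z)_i − w^max_{D′}(z)_i ≤ w^max_D(z⁺)_i − w^min_D(z⁺)_i`. -/
theorem kinky_upper_refinement (d n : ℕ) (Z : Set (EuclideanSpace ℝ (Fin d)))
    (f : EuclideanSpace ℝ (Fin d) → EuclideanSpace ℝ (Fin n)) (q lam : ℝ)
    (hq : 0 < q) (hlam0 : 0 < lam) (hlam1 : lam ≤ 1)
    (hf : ∀ z₁ ∈ Z, ∀ z₂ ∈ Z, ‖f z₁ - f z₂‖ ≤ q * ‖z₁ - z₂‖ ^ lam)
    (D : Finset (EuclideanSpace ℝ (Fin d))) (hD : D.Nonempty) (hDZ : ↑D ⊆ Z)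
    (zplus : EuclideanSpace ℝ (Fin d)) (hzplus : zplus ∈ Z) :
    ∀ z : EuclideanSpace ℝ (Fin d), ∀ i : Fin n,
      0 ≤ wmax f q lam D hD z i -
            wmax f q lam (insert zplus D) (Finset.insert_nonempty _ _) z i ∧
      wmax f q lam D hD z i -
            wmax f q lam (insert zplus D) (Finset.insert_nonempty _ _) z i ≤
        wmax f q lam D hD zplus i - wmin f q lam D hD zplus i := by
  intro z i
  have habs : ∀ y ∈ D, |f zplus i - f y i| ≤ q * ‖zplus - y‖ ^ lam := fun y hy =>
    (PiLp.norm_apply_le (f zplus - f y) i).trans (hf zplus hzplus y (hDZ hy))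
  have hmin : wmin f q lam D hD zplus i ≤ f zplus i :=
    Finset.sup'_le _ _ fun y hy => by linarith [neg_abs_le (f zplus i - f y i), habs y hy]
  have hmax : f zplus i ≤ wmax f q lam D hD zplus i :=
    Finset.le_inf' _ _ fun y hy => by linarith [le_abs_self (f zplus i - f y i), habs y hy]
  have hinsert : wmax f q lam (insert zplus D) (Finset.insert_nonempty _ _) z i =
      min (f zplus i + q * ‖z - zplus‖ ^ lam) (wmax f q lam D hD z i) :=
    Finset.inf'_insert hD _
  have hholder := wmax_le_wmax_add f hq.le hlam0.le hlam1 D hD z zplus i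
  rw [hinsert]
  refine ⟨sub_nonneg.2 (min_le_right _ _), ?_⟩
  rw [sub_le_comm]
  exact le_min (by linarith) (by linarith)
end

section
/- (Lemma 2.) There exists a class K∞ function α₇, depending only on Z, n, q and λ, with the following property: for every sequence (z_t)_{t≥0} with z_t ∈ Z for all t, defining the data sets D₀ := {z*} for an arbitrary fixed z* ∈ Z and D_{t+1} := D_t ∪ {z_t}, and defining the uncertainty size C_t := ∫_Z h_{D_t}(z) dz (Lebesgue measure), one has C_{t+1} − C_t ≤ −α₇(h_{D_t}(z_t)) for all t ≥ 0. -/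
open scoped Classical

/-- The uncertainty level `h_D(z) := ‖w^max_D(z) − w^min_D(z)‖` (Euclidean norm). -/
noncomputable def hunc {d n : ℕ} (f : EuclideanSpace ℝ (Fin d) → EuclideanSpace ℝ (Fin n))
    (q lam : ℝ) (D : Finset (EuclideanSpace ℝ (Fin d))) (hD : D.Nonempty)
    (z : EuclideanSpace ℝ (Fin d)) : ℝ :=
  ‖(EuclideanSpace.equiv (Fin n) ℝ).symm fun i =>
      wmax f q lam D hD z i - wmin f q lam D hD z i‖

/-- The data sets `D₀ := {z*}` and `D_{t+1} := D_t ∪ {z_t}`. -/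
noncomputable def DSeq {d : ℕ} (zstar : EuclideanSpace ℝ (Fin d))
    (zs : ℕ → EuclideanSpace ℝ (Fin d)) : ℕ → Finset (EuclideanSpace ℝ (Fin d))
  | 0 => {zstar}
  | t + 1 => insert (zs t) (DSeq zstar zs t)

/-- Each data set `D_t` is nonempty. -/
theorem DSeq_nonempty {d : ℕ} (zstar : EuclideanSpace ℝ (Fin d))
    (zs : ℕ → EuclideanSpace ℝ (Fin d)) : ∀ t, (DSeq zstar zs t).Nonempty
  | 0 => ⟨zstar, by simp [DSeq]⟩
  | t + 1 => Finset.insert_nonempty _ _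

/-- A class `K∞` function: strictly increasing on `[0, ∞)`, vanishing at `0`, mapping
`[0, ∞)` into `[0, ∞)`, and tending to `∞` at `∞`. -/
def IsKInf (α : ℝ → ℝ) : Prop :=
  StrictMonoOn α (Set.Ici 0) ∧ α 0 = 0 ∧ (∀ t, 0 ≤ t → 0 ≤ α t) ∧
    Filter.Tendsto α Filter.atTop Filter.atTop

section KinkyInference

variable {d n : ℕ} (f : EuclideanSpace ℝ (Fin d) → EuclideanSpace ℝ (Fin n)) {q lam : ℝ}

/-- The componentwise width `w^max_D(z) − w^min_D(z)` of the confidence bounds, as a vector. -/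
noncomputable def width (q lam : ℝ) (D : Finset (EuclideanSpace ℝ (Fin d))) (hD : D.Nonempty)
    (z : EuclideanSpace ℝ (Fin d)) : EuclideanSpace ℝ (Fin n) :=
  WithLp.toLp 2 fun i => wmax f q lam D hD z i - wmin f q lam D hD z i

theorem hunc_eq_norm_width (q lam : ℝ) (D : Finset (EuclideanSpace ℝ (Fin d))) (hD : D.Nonempty)
    (z : EuclideanSpace ℝ (Fin d)) : hunc f q lam D hD z = ‖width f q lam D hD z‖ := rfl

theorem EuclideanSpace.norm_le_of_abs_le {x y : EuclideanSpace ℝ (Fin n)}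
    (h : ∀ i, |x i| ≤ |y i|) : ‖x‖ ≤ ‖y‖ := by
  rw [EuclideanSpace.norm_eq, EuclideanSpace.norm_eq]
  refine Real.sqrt_le_sqrt (Finset.sum_le_sum fun i _ => ?_)
  exact pow_le_pow_left₀ (norm_nonneg _) (h i) 2

theorem EuclideanSpace.norm_le_card_add_one_mul {x : EuclideanSpace ℝ (Fin n)} {c : ℝ} (hc : 0 ≤ c)
    (h : ∀ i, |x i| ≤ c) : ‖x‖ ≤ (n + 1) * c := by
  rw [EuclideanSpace.norm_eq]
  refine Real.sqrt_le_iff.mpr ⟨by positivity, ?_⟩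
  calc ∑ i, ‖x i‖ ^ 2 ≤ ∑ _i : Fin n, c ^ 2 :=
        Finset.sum_le_sum fun i _ => pow_le_pow_left₀ (norm_nonneg _) (h i) 2
    _ = n * c ^ 2 := by simp
    _ ≤ ((n + 1) * c) ^ 2 := by
        have hn : (0 : ℝ) ≤ n := n.cast_nonneg
        nlinarith [mul_nonneg hn (sq_nonneg c), mul_nonneg (mul_nonneg hn hn) (sq_nonneg c),
          sq_nonneg c]

theorem norm_sub_rpow_le {E : Type*} [SeminormedAddCommGroup E] (hlam0 : 0 ≤ lam)
    (hlam1 : lam ≤ 1) (x y z : E) : ‖x - z‖ ^ lam ≤ ‖x - y‖ ^ lam + ‖y - z‖ ^ lam :=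
  (Real.rpow_le_rpow (norm_nonneg _) (norm_sub_le_norm_sub_add_norm_sub x y z) hlam0).trans
    (Real.rpow_add_le_add_rpow (norm_nonneg _) (norm_nonneg _) hlam0 hlam1)

variable {f} {D D' : Finset (EuclideanSpace ℝ (Fin d))} {hD : D.Nonempty} {hD' : D'.Nonempty}

theorem wmax_le_add (hq : 0 ≤ q) (hlam0 : 0 ≤ lam) (hlam1 : lam ≤ 1)
    (x z : EuclideanSpace ℝ (Fin d)) (i : Fin n) :
    wmax f q lam D hD x i ≤ wmax f q lam D hD z i + q * ‖x - z‖ ^ lam := by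
  rw [← sub_le_iff_le_add]
  refine Finset.le_inf' _ _ fun y hy => ?_
  have h1 : wmax f q lam D hD x i ≤ f y i + q * ‖x - y‖ ^ lam := Finset.inf'_le _ hy
  have h2 := mul_le_mul_of_nonneg_left (norm_sub_rpow_le hlam0 hlam1 x z y) hq
  linarith

theorem le_wmin_add (hq : 0 ≤ q) (hlam0 : 0 ≤ lam) (hlam1 : lam ≤ 1)
    (x z : EuclideanSpace ℝ (Fin d)) (i : Fin n) :
    wmin f q lam D hD z i ≤ wmin f q lam D hD x i + q * ‖x - z‖ ^ lam := by
  refine Finset.sup'_le _ _ fun y hy => ?_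
  have h1 : f y i - q * ‖x - y‖ ^ lam ≤ wmin f q lam D hD x i :=
    Finset.le_sup' (fun y => f y i - q * ‖x - y‖ ^ lam) hy
  have h2 := mul_le_mul_of_nonneg_left (norm_sub_rpow_le hlam0 hlam1 x z y) hq
  linarith

theorem hunc_le_hunc_add (hq : 0 ≤ q) (hlam0 : 0 ≤ lam) (hlam1 : lam ≤ 1)
    (x z : EuclideanSpace ℝ (Fin d)) :
    hunc f q lam D hD x ≤ hunc f q lam D hD z + (n + 1) * (2 * q * ‖z - x‖ ^ lam) := by
  rw [hunc_eq_norm_width, hunc_eq_norm_width, ← sub_le_iff_le_add']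
  refine (norm_sub_norm_le _ _).trans
    (EuclideanSpace.norm_le_card_add_one_mul (by positivity) fun i => ?_)
  have h1 := wmax_le_add (f := f) (hD := hD) hq hlam0 hlam1 x z i
  have h2 := wmax_le_add (f := f) (hD := hD) hq hlam0 hlam1 z x i
  have h3 := le_wmin_add (f := f) (hD := hD) hq hlam0 hlam1 x z i
  have h4 := le_wmin_add (f := f) (hD := hD) hq hlam0 hlam1 z x i
  rw [norm_sub_rev x z] at h1 h3
  simp only [width, PiLp.sub_apply]
  rw [abs_le]
  constructor <;> linarith

theorem continuous_hunc (hlam0 : 0 ≤ lam) : Continuous (hunc f q lam D hD) := by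
  have hrpow (y : EuclideanSpace ℝ (Fin d)) : Continuous fun z => ‖z - y‖ ^ lam :=
    (by fun_prop : Continuous fun z : EuclideanSpace ℝ (Fin d) => ‖z - y‖).rpow_const
      fun _ => Or.inr hlam0
  have hmax (i : Fin n) : Continuous fun z => wmax f q lam D hD z i :=
    Continuous.finset_inf'_apply hD fun y _ => continuous_const.add ((hrpow y).const_mul q)
  have hmin (i : Fin n) : Continuous fun z => wmin f q lam D hD z i :=
    Continuous.finset_sup'_apply hD fun y _ => continuous_const.sub ((hrpow y).const_mul q)
  exact ((PiLp.continuous_toLp 2 _).comp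
    (continuous_pi fun i => (hmax i).sub (hmin i))).norm

theorem wmin_le_wmax {Z : Set (EuclideanSpace ℝ (Fin d))}
    (hf : ∀ z₁ ∈ Z, ∀ z₂ ∈ Z, ‖f z₁ - f z₂‖ ≤ q * ‖z₁ - z₂‖ ^ lam) (hDZ : ∀ y ∈ D, y ∈ Z)
    {z : EuclideanSpace ℝ (Fin d)} (hz : z ∈ Z) (i : Fin n) :
    wmin f q lam D hD z i ≤ wmax f q lam D hD z i := by
  have key (y) (hy : y ∈ D) : |f z i - f y i| ≤ q * ‖z - y‖ ^ lam :=
    (PiLp.norm_apply_le (f z - f y) i).trans (hf z hz y (hDZ y hy))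
  refine (Finset.sup'_le _ _ fun y hy => ?_).trans
    (Finset.le_inf' _ _ fun y hy => ?_ : f z i ≤ _)
  · linarith [(abs_le.mp (key y hy)).1]
  · linarith [(abs_le.mp (key y hy)).2]

theorem hunc_anti (hDD' : D ⊆ D') {z : EuclideanSpace ℝ (Fin d)}
    (h : ∀ i, wmin f q lam D' hD' z i ≤ wmax f q lam D' hD' z i) :
    hunc f q lam D' hD' z ≤ hunc f q lam D hD z := by
  rw [hunc_eq_norm_width, hunc_eq_norm_width]
  refine EuclideanSpace.norm_le_of_abs_le fun i => abs_le_abs_of_nonneg (sub_nonneg.mpr (h i)) ?_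
  exact sub_le_sub (Finset.inf'_mono _ hDD' hD) (Finset.sup'_mono _ hDD' hD)

theorem hunc_le_of_mem (hq : 0 ≤ q) {x z : EuclideanSpace ℝ (Fin d)} (hx : x ∈ D)
    (h : ∀ i, wmin f q lam D hD z i ≤ wmax f q lam D hD z i) :
    hunc f q lam D hD z ≤ (n + 1) * (2 * q * ‖z - x‖ ^ lam) := by
  rw [hunc_eq_norm_width]
  refine EuclideanSpace.norm_le_card_add_one_mul (by positivity) fun i => ?_
  have h1 : wmax f q lam D hD z i ≤ f x i + q * ‖z - x‖ ^ lam := Finset.inf'_le _ hx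
  have h2 : f x i - q * ‖z - x‖ ^ lam ≤ wmin f q lam D hD z i :=
    Finset.le_sup' (fun y => f y i - q * ‖z - y‖ ^ lam) hx
  refine (abs_of_nonneg (sub_nonneg.mpr (h i))).trans_le ?_
  linarith

end KinkyInference

theorem DSeq_subset {d : ℕ} {Z : Set (EuclideanSpace ℝ (Fin d))}
    {zstar : EuclideanSpace ℝ (Fin d)} {zs : ℕ → EuclideanSpace ℝ (Fin d)} (h : zstar ∈ Z)
    (hs : ∀ t, zs t ∈ Z) : ∀ t, ∀ y ∈ DSeq zstar zs t, y ∈ Z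
  | 0, y, hy => by
    rw [DSeq, Finset.mem_singleton] at hy
    exact hy ▸ h
  | t + 1, y, hy => by
    rw [DSeq, Finset.mem_insert] at hy
    rcases hy with rfl | hy
    · exact hs t
    · exact DSeq_subset h hs t y hy

/-- The factor by which `Z` (of diameter less than `R`) is contracted towards the new sample. -/
noncomputable def contractionRatio (c lam R t : ℝ) : ℝ := min 1 ((t / c) ^ lam⁻¹ / R)

theorem contractionRatio_nonneg {c lam R t : ℝ} (hc : 0 < c) (hR : 0 < R) (ht : 0 ≤ t) :
    0 ≤ contractionRatio c lam R t :=
  le_min zero_le_one (by positivity)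

theorem contractionRatio_pos {c lam R t : ℝ} (hc : 0 < c) (hR : 0 < R) (ht : 0 < t) :
    0 < contractionRatio c lam R t :=
  lt_min zero_lt_one (by positivity)

theorem contractionRatio_mono {c lam R s t : ℝ} (hc : 0 < c) (hlam : 0 < lam) (hR : 0 < R)
    (hs : 0 ≤ s) (hst : s ≤ t) : contractionRatio c lam R s ≤ contractionRatio c lam R t := by
  unfold contractionRatio
  gcongr

theorem mul_rpow_contractionRatio_le {c lam R t : ℝ} (hc : 0 < c) (hlam : 0 < lam) (hR : 0 < R)
    (ht : 0 ≤ t) : c * (contractionRatio c lam R t * R) ^ lam ≤ t := by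
  have h : contractionRatio c lam R t * R ≤ (t / c) ^ lam⁻¹ :=
    (le_div_iff₀ hR).mp (min_le_right _ _)
  calc c * (contractionRatio c lam R t * R) ^ lam ≤ c * ((t / c) ^ lam⁻¹) ^ lam := by
        have := contractionRatio_nonneg (lam := lam) hc hR ht
        gcongr
    _ = t := by
        rw [Real.rpow_inv_rpow (by positivity) hlam.ne', mul_div_cancel₀ _ hc.ne']

theorem isKInf_contractionRatio {c lam R V : ℝ} (hc : 0 < c) (hlam : 0 < lam) (hR : 0 < R)
    (hV : 0 < V) (d : ℕ) : IsKInf fun t => t / 2 * (contractionRatio c lam R t ^ d * V) := by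
  have hmono {s t : ℝ} (hs : 0 ≤ s) (hst : s ≤ t) :
      contractionRatio c lam R s ^ d * V ≤ contractionRatio c lam R t ^ d * V := by
    gcongr
    · exact contractionRatio_nonneg hc hR hs
    · exact contractionRatio_mono hc hlam hR hs hst
  have hpos {t : ℝ} (ht : 0 < t) : 0 < contractionRatio c lam R t ^ d * V :=
    mul_pos (pow_pos (contractionRatio_pos hc hR ht) d) hV
  refine ⟨fun s hs t _ hst => ?_, by simp, fun t ht => ?_, ?_⟩
  · have hs : 0 ≤ s := hs
    exact (mul_le_mul_of_nonneg_left (hmono hs hst.le) (by positivity)).trans_lt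
      (mul_lt_mul_of_pos_right (by linarith) (hpos (hs.trans_lt hst)))
  · have := contractionRatio_nonneg (lam := lam) hc hR ht
    positivity
  · refine Filter.tendsto_atTop_mono' _ ?_
      ((Filter.tendsto_id.atTop_div_const two_pos).atTop_mul_const (hpos one_pos))
    filter_upwards [Filter.eventually_ge_atTop 1] with t ht
    exact mul_le_mul_of_nonneg_left (hmono zero_le_one ht) (by simp only [id]; positivity)

/-- Lemma 2: there exists a class-`K∞` function `α₇`, depending only on
`Z`, `n`, `q` and `λ`, such that along any trajectory in `Z` the uncertainty size
`C_t := ∫_Z h_{D_t}(z) dz` satisfies `C_{t+1} − C_t ≤ −α₇(h_{D_t}(z_t))`. -/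
theorem uncertainty_size_decrease (d n : ℕ) (Z : Set (EuclideanSpace ℝ (Fin d)))
    (hZc : IsCompact Z) (hZconv : Convex ℝ Z) (hZint : (interior Z).Nonempty)
    (q lam : ℝ) (hq : 0 < q) (hlam0 : 0 < lam) (hlam1 : lam ≤ 1) :
    ∃ α₇ : ℝ → ℝ, IsKInf α₇ ∧
      ∀ f : EuclideanSpace ℝ (Fin d) → EuclideanSpace ℝ (Fin n),
        (∀ z₁ ∈ Z, ∀ z₂ ∈ Z, ‖f z₁ - f z₂‖ ≤ q * ‖z₁ - z₂‖ ^ lam) →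
        ∀ zstar ∈ Z, ∀ zs : ℕ → EuclideanSpace ℝ (Fin d), (∀ t, zs t ∈ Z) →
          ∀ t : ℕ,
            (∫ z in Z, hunc f q lam (DSeq zstar zs (t + 1)) (DSeq_nonempty zstar zs (t + 1)) z) -
              (∫ z in Z, hunc f q lam (DSeq zstar zs t) (DSeq_nonempty zstar zs t) z) ≤
            -α₇ (hunc f q lam (DSeq zstar zs t) (DSeq_nonempty zstar zs t) (zs t)) := by
  have hZvol : 0 < MeasureTheory.volume.real Z :=
    ENNReal.toReal_pos (MeasureTheory.Measure.measure_pos_of_nonempty_interior _ hZint).ne'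
      hZc.measure_ne_top
  have hc : 0 < 8 * (n + 1) * q := by positivity
  have hR : 0 < Metric.diam Z + 1 := by linarith [Metric.diam_nonneg (s := Z)]
  refine ⟨_, isKInf_contractionRatio hc hlam0 hR hZvol d, fun f hf zstar hzstar zs hzs t => ?_⟩
  set D := DSeq zstar zs t
  set D' := DSeq zstar zs (t + 1)
  have hD := DSeq_nonempty zstar zs t
  have hD' := DSeq_nonempty zstar zs (t + 1)
  have hDD' : D ⊆ D' := Finset.subset_insert _ _
  have hx : zs t ∈ D' := Finset.mem_insert_self _ _
  have hle {z} (hz : z ∈ Z) (i) : wmin f q lam D' hD' z i ≤ wmax f q lam D' hD' z i :=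
    wmin_le_wmax hf (DSeq_subset hzstar hzs (t + 1)) hz i
  set h₀ := hunc f q lam D hD (zs t)
  have hh₀_nonneg : 0 ≤ h₀ := norm_nonneg _
  set s := contractionRatio (8 * (n + 1) * q) lam (Metric.diam Z + 1) h₀
  have hs0 : 0 ≤ s := contractionRatio_nonneg hc hR hh₀_nonneg
  have hs1 : s ≤ 1 := min_le_left _ _
  set S := AffineMap.homothety (zs t) s '' Z with hS
  have hSc : IsCompact S := hZc.image (AffineMap.homothety_continuous _ _)
  have hSZ : S ⊆ Z := by
    rintro _ ⟨z, hz, rfl⟩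
    exact hZconv.lineMap_mem (hzs t) hz ⟨hs0, hs1⟩
  have hSvol : MeasureTheory.volume.real S = s ^ d * MeasureTheory.volume.real Z := by
    rw [hS, MeasureTheory.measureReal_def, MeasureTheory.Measure.addHaar_image_homothety,
      ENNReal.toReal_mul, finrank_euclideanSpace_fin, ENNReal.toReal_ofReal (abs_nonneg _),
      abs_of_nonneg (pow_nonneg hs0 d), MeasureTheory.measureReal_def]
  have hdrop {z} (hz : z ∈ S) : h₀ / 2 ≤ hunc f q lam D hD z - hunc f q lam D' hD' z := by
    have h1 : hunc f q lam D hD (zs t) ≤ _ :=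
      hunc_le_hunc_add (f := f) (hD := hD) hq.le hlam0.le hlam1 (zs t) z
    have h2 := hunc_le_of_mem hq.le hx (hle (hSZ hz))
    have hnorm : ‖z - zs t‖ ≤ s * (Metric.diam Z + 1) := by
      obtain ⟨w, hw, rfl⟩ := hz
      rw [← dist_eq_norm, dist_homothety_center, Real.norm_of_nonneg hs0, dist_comm]
      gcongr
      linarith [Metric.dist_le_diam_of_mem hZc.isBounded hw (hzs t)]
    have h3 : 8 * (n + 1) * q * ‖z - zs t‖ ^ lam ≤ h₀ :=
      le_trans (by gcongr) (mul_rpow_contractionRatio_le hc hlam0 hR hh₀_nonneg)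
    linarith
  have hint (D : Finset (EuclideanSpace ℝ (Fin d))) (hD : D.Nonempty) :
      MeasureTheory.IntegrableOn (hunc f q lam D hD) Z :=
    (continuous_hunc hlam0.le).continuousOn.integrableOn_compact hZc
  have hdiff := (hint D hD).sub (hint D' hD')
  have hlower : h₀ / 2 * (s ^ d * MeasureTheory.volume.real Z) ≤
      ∫ z in Z, (hunc f q lam D hD z - hunc f q lam D' hD' z) := by
    calc h₀ / 2 * (s ^ d * MeasureTheory.volume.real Z) = ∫ _ in S, h₀ / 2 := by
          rw [MeasureTheory.setIntegral_const, smul_eq_mul, hSvol, mul_comm]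
      _ ≤ ∫ z in S, (hunc f q lam D hD z - hunc f q lam D' hD' z) :=
          MeasureTheory.setIntegral_mono_on
            (MeasureTheory.integrableOn_const hSc.measure_ne_top)
            (hdiff.mono_set hSZ) hSc.measurableSet fun z hz => hdrop hz
      _ ≤ _ := by
          refine MeasureTheory.setIntegral_mono_set hdiff ?_ hSZ.eventuallyLE
          filter_upwards [MeasureTheory.ae_restrict_mem hZc.measurableSet] with z hz
          exact sub_nonneg.mpr (hunc_anti hDD' (hle hz))
  rw [MeasureTheory.integral_sub (hint D hD) (hint D' hD')] at hlower
  linarith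
end
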